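/- There exists an absolute positive constant K₃ such that the following holds. Let U be an n×n real matrix with UᵀU = n·I and coherence μ = μ(U). Fix T ⊆ {1,…,n} and δ ∈ (0,1). Let Ω = {k : δ_k = 1}, where δ₁,…,δ_n are i.i.d. Bernoulli random variables with P(δ_k = 1) = m/n (Bernoulli sampling model), and let z ∈ {−1,+1}^T be a uniformly random sign sequence independent of Ω. If m ≥ K₃ · μ² · max(|T|, log(n/δ)) · log(n/δ), then with probability at least 1 − δ, every x⁰ ∈ ℝⁿ supported on T whose sign sequence on T equals z is the unique solution of min_x ‖x‖_{ℓ₁} subject to U_Ω x = U_Ω x⁰. -/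

import Mathlib

open Classical Finset Matrix Real

/-- Spectral (operator ℓ²) norm of a real matrix. -/
noncomputable def specNorm {ι κ : Type*} [Fintype ι] [Fintype κ] [DecidableEq κ]
    (A : Matrix ι κ ℝ) : ℝ :=
  ‖LinearMap.toContinuousLinearMap (Matrix.toEuclideanLin A)‖

/-- Coherence: the largest magnitude among the entries of `U`. -/
noncomputable def coh {n : ℕ} (U : Matrix (Fin n) (Fin n) ℝ) : ℝ :=
  ⨆ k, ⨆ j, |U k j|

/-- Uniform probability of the event `E` on the finite sample space `s`. -/
noncomputable def uprob {α : Type*} (s : Finset α) (E : α → Prop) : ℝ :=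
  ((s.filter E).card : ℝ) / s.card

/-- Weight of the outcome `ω` for i.i.d. Bernoulli(m/n) variables `δ_k = ω k`. -/
noncomputable def bweight (n m : ℕ) (ω : Fin n → Bool) : ℝ :=
  ∏ k, if ω k then (m : ℝ) / n else 1 - (m : ℝ) / n

/-- Expectation under the i.i.d. Bernoulli(m/n) model. -/
noncomputable def bexp (n m : ℕ) (f : (Fin n → Bool) → ℝ) : ℝ :=
  ∑ ω : Fin n → Bool, bweight n m ω * f ω

/-- Probability of an event under the i.i.d. Bernoulli(m/n) model. -/
noncomputable def bprob (n m : ℕ) (E : (Fin n → Bool) → Prop) : ℝ :=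
  ∑ ω : Fin n → Bool, if E ω then bweight n m ω else 0

/-- Euclidean norm of a finitely indexed real vector. -/
noncomputable def l2norm {ι : Type*} [Fintype ι] (v : ι → ℝ) : ℝ :=
  Real.sqrt (∑ i, v i ^ 2)

/-- Probability of an event for the pair `(δ, z)` where `δ₁,…,δ_n` are i.i.d.
Bernoulli(m/n) variables and `z : T → {±1}` is an independent uniformly random
sign sequence. -/
noncomputable def jprob (n m : ℕ) {T : Finset (Fin n)}
    (E : (Fin n → Bool) × (↥T → Bool) → Prop) : ℝ :=
  ∑ p : (Fin n → Bool) × (↥T → Bool),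
    if E p then bweight n m p.1 * ((1 : ℝ) / 2) ^ T.card else 0

theorem exists_pow_eq_conj_diagonal {ι : Type*} [Fintype ι] [DecidableEq ι]
    {A : Matrix ι ι ℝ} (hA : Aᵀ = A) :
    ∃ (l : ι → ℝ) (V : Matrix ι ι ℝ), V * Vᵀ = 1 ∧ Vᵀ * V = 1 ∧
      ∀ i : ℕ, A ^ i = V * diagonal (fun a => l a ^ i) * Vᵀ := by
  have hH : A.IsHermitian := by
    rw [Matrix.IsHermitian, conjTranspose_eq_transpose_of_trivial, hA]
  have h := hH.spectral_theorem
  obtain ⟨h1, h2⟩ := Unitary.mem_iff.1 hH.eigenvectorUnitary.2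
  set V : Matrix ι ι ℝ := (hH.eigenvectorUnitary : Matrix ι ι ℝ) with hV
  rw [star_eq_conjTranspose, conjTranspose_eq_transpose_of_trivial] at h1 h2
  have hA1 : A = V * diagonal hH.eigenvalues * Vᵀ := by
    conv_lhs => rw [h]
    simp [Unitary.conjStarAlgAut_apply, hV, star_eq_conjTranspose]
  refine ⟨hH.eigenvalues, V, h2, h1, fun i => ?_⟩
  induction i with
  | zero => simp [h2]
  | succ i ih =>
    rw [pow_succ, ih]
    nth_rw 2 [hA1]
    calc _ = V * diagonal (fun a => hH.eigenvalues a ^ i) * (Vᵀ * V) *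
          diagonal hH.eigenvalues * Vᵀ := by simp only [Matrix.mul_assoc]
      _ = _ := by
        rw [h1, Matrix.mul_one, Matrix.mul_assoc V, diagonal_mul_diagonal]
        simp only [pow_succ]

theorem exists_spectral_weights {ι : Type*} [Fintype ι] [DecidableEq ι]
    {A : Matrix ι ι ℝ} (hA : Aᵀ = A) :
    ∃ l : ι → ℝ, (∀ i : ℕ, (A ^ i).trace = ∑ a, l a ^ i) ∧
      ∀ u : ι → ℝ, ∃ w : ι → ℝ, (∀ a, 0 ≤ w a) ∧
        ∀ i : ℕ, u ⬝ᵥ (A ^ i *ᵥ u) = ∑ a, w a * l a ^ i := by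
  obtain ⟨l, V, _, h2, h⟩ := exists_pow_eq_conj_diagonal hA
  refine ⟨l, fun i => ?_, fun u => ⟨fun a => (Vᵀ *ᵥ u) a ^ 2, fun a => sq_nonneg _, fun i => ?_⟩⟩
  · rw [h, Matrix.trace_mul_comm, ← Matrix.mul_assoc, h2, Matrix.one_mul, trace_diagonal]
  · rw [h, ← Matrix.mulVec_mulVec, ← Matrix.mulVec_mulVec, Matrix.dotProduct_mulVec,
      ← Matrix.mulVec_transpose]
    simp only [dotProduct, mulVec_diagonal]
    exact Finset.sum_congr rfl fun a _ => by ring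

theorem sum_pow_mul_pow_le (s : ℕ) (hs : Even s) (x y : ℝ) :
    ∑ i ∈ range (s + 1), x ^ i * y ^ (s - i) ≤ ((s : ℝ) + 1) / 2 * (x ^ s + y ^ s) := by
  have hrefl : ∑ i ∈ range (s + 1), x ^ i * y ^ (s - i)
      = ∑ i ∈ range (s + 1), x ^ (s - i) * y ^ i := by
    rw [← Finset.sum_range_reflect]
    refine Finset.sum_congr rfl fun i hi => ?_
    have := Finset.mem_range.1 hi
    rw [show s + 1 - 1 - i = s - i by omega, show s - (s - i) = i by omega]
  have key : ∀ i ∈ range (s + 1),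
      x ^ i * y ^ (s - i) + x ^ (s - i) * y ^ i ≤ x ^ s + y ^ s := by
    intro i hi
    have hi' : i + (s - i) = s := by have := Finset.mem_range.1 hi; omega
    have h1 : 0 ≤ (|x| ^ i - |y| ^ i) * (|x| ^ (s - i) - |y| ^ (s - i)) := by
      rcases le_total |x| |y| with h | h
      · exact mul_nonneg_of_nonpos_of_nonpos
          (sub_nonpos.2 (pow_le_pow_left₀ (abs_nonneg _) h _))
          (sub_nonpos.2 (pow_le_pow_left₀ (abs_nonneg _) h _))
      · exact mul_nonneg
          (sub_nonneg.2 (pow_le_pow_left₀ (abs_nonneg _) h _))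
          (sub_nonneg.2 (pow_le_pow_left₀ (abs_nonneg _) h _))
    have hx : |x| ^ i * |x| ^ (s - i) = x ^ s := by rw [← pow_add, hi', hs.pow_abs]
    have hy : |y| ^ i * |y| ^ (s - i) = y ^ s := by rw [← pow_add, hi', hs.pow_abs]
    have e1 : x ^ i * y ^ (s - i) ≤ |x| ^ i * |y| ^ (s - i) := by
      rw [← abs_pow, ← abs_pow, ← abs_mul]; exact le_abs_self _
    have e2 : x ^ (s - i) * y ^ i ≤ |x| ^ (s - i) * |y| ^ i := by
      rw [← abs_pow, ← abs_pow, ← abs_mul]; exact le_abs_self _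
    nlinarith
  have h2 := Finset.sum_le_sum key
  rw [Finset.sum_add_distrib, ← hrefl, Finset.sum_const, card_range, nsmul_eq_mul] at h2
  push_cast at h2
  linarith

theorem pow_sub_pow_eq_sum {R : Type*} [Ring R] (A B : R) (s : ℕ) :
    A ^ (s + 1) - B ^ (s + 1) = ∑ i ∈ range (s + 1), A ^ i * (A - B) * B ^ (s - i) := by
  induction s with
  | zero => simp
  | succ s ih =>
    rw [Finset.sum_range_succ]
    have : ∑ i ∈ range (s + 1), A ^ i * (A - B) * B ^ (s + 1 - i)
        = (∑ i ∈ range (s + 1), A ^ i * (A - B) * B ^ (s - i)) * B := by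
      rw [Finset.sum_mul]
      refine Finset.sum_congr rfl fun i hi => ?_
      have := Finset.mem_range.1 hi
      rw [show s + 1 - i = (s - i) + 1 by omega, pow_succ B, mul_assoc _ _ B]
    rw [this, ← ih, Nat.sub_self, pow_zero, mul_one, pow_succ A (s+1), pow_succ B (s+1)]
    noncomm_ring

theorem dotProduct_pow_sub_pow_le {ι : Type*} [Fintype ι] [DecidableEq ι]
    {A B : Matrix ι ι ℝ} (hA : Aᵀ = A) (hB : Bᵀ = B) {c : ℝ} (hc : 0 ≤ c) (u : ι → ℝ)
    (hAB : A - B = c • vecMulVec u u) {s : ℕ} (hs : Even s) :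
    u ⬝ᵥ (A ^ (s + 1) *ᵥ u) - u ⬝ᵥ (B ^ (s + 1) *ᵥ u) ≤
      ((s : ℝ) + 1) / 2 * (c * (u ⬝ᵥ u)) *
        (u ⬝ᵥ (A ^ s *ᵥ u) + u ⬝ᵥ (B ^ s *ᵥ u)) := by
  have h1 : u ⬝ᵥ (A ^ (s + 1) *ᵥ u) - u ⬝ᵥ (B ^ (s + 1) *ᵥ u) =
      c * ∑ i ∈ range (s + 1), (u ⬝ᵥ (A ^ i *ᵥ u)) * (u ⬝ᵥ (B ^ (s - i) *ᵥ u)) := by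
    rw [← dotProduct_sub, ← sub_mulVec, pow_sub_pow_eq_sum, Matrix.sum_mulVec, dotProduct_sum,
      Finset.mul_sum]
    refine Finset.sum_congr rfl fun i _ => ?_
    rw [hAB, ← mulVec_mulVec, ← mulVec_mulVec, smul_mulVec, vecMulVec_mulVec]
    simp only [mulVec_smul, dotProduct_smul, smul_eq_mul, op_smul_eq_smul]
    ring
  obtain ⟨l, -, hl⟩ := exists_spectral_weights hA
  obtain ⟨l', -, hl'⟩ := exists_spectral_weights hB
  obtain ⟨w, hw0, hw⟩ := hl u
  obtain ⟨v, hv0, hv⟩ := hl' u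
  have hwu : ∑ a, w a = u ⬝ᵥ u := by simpa using (hw 0).symm
  have hvu : ∑ a, v a = u ⬝ᵥ u := by simpa using (hv 0).symm
  have h2 : ∑ i ∈ range (s + 1), (u ⬝ᵥ (A ^ i *ᵥ u)) * (u ⬝ᵥ (B ^ (s - i) *ᵥ u)) =
      ∑ a, ∑ b, w a * v b * ∑ i ∈ range (s + 1), l a ^ i * l' b ^ (s - i) := by
    simp only [hw, hv, Finset.sum_mul_sum]
    rw [Finset.sum_comm]
    refine Finset.sum_congr rfl fun a _ => ?_
    rw [Finset.sum_comm]
    refine Finset.sum_congr rfl fun b _ => ?_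
    rw [Finset.mul_sum]
    exact Finset.sum_congr rfl fun i _ => by ring
  have h3 : ∑ a, ∑ b, w a * v b * ∑ i ∈ range (s + 1), l a ^ i * l' b ^ (s - i) ≤
      ∑ a, ∑ b, w a * v b * (((s : ℝ) + 1) / 2 * (l a ^ s + l' b ^ s)) :=
    Finset.sum_le_sum fun a _ => Finset.sum_le_sum fun b _ =>
      mul_le_mul_of_nonneg_left (sum_pow_mul_pow_le s hs _ _) (mul_nonneg (hw0 a) (hv0 b))
  have h4 : ∑ a, ∑ b, w a * v b * (((s : ℝ) + 1) / 2 * (l a ^ s + l' b ^ s)) =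
      ((s : ℝ) + 1) / 2 * (u ⬝ᵥ u) * (u ⬝ᵥ (A ^ s *ᵥ u) + u ⬝ᵥ (B ^ s *ᵥ u)) := by
    have e : ∀ a b, w a * v b * (((s : ℝ) + 1) / 2 * (l a ^ s + l' b ^ s)) =
        ((s : ℝ) + 1) / 2 * ((w a * l a ^ s) * v b) +
          ((s : ℝ) + 1) / 2 * (w a * (v b * l' b ^ s)) := fun a b => by ring
    simp only [e, Finset.sum_add_distrib, ← Finset.mul_sum, ← Finset.sum_mul, hwu, hvu, hw, hv]
    ring
  rw [h1, h2]
  calc _ ≤ c * (((s : ℝ) + 1) / 2 * (u ⬝ᵥ u) * (u ⬝ᵥ (A ^ s *ᵥ u) + u ⬝ᵥ (B ^ s *ᵥ u))) :=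
        mul_le_mul_of_nonneg_left (h3.trans h4.le) hc
    _ = _ := by ring

theorem dotProduct_mulVec_le_of_trace_pow {ι : Type*} [Fintype ι] [DecidableEq ι]
    {A : Matrix ι ι ℝ} (hA : Aᵀ = A) {N : ℕ} (h : (A ^ (2 * N)).trace < (1 / 4) ^ N)
    (u : ι → ℝ) : |u ⬝ᵥ (A *ᵥ u)| ≤ 1 / 2 * (u ⬝ᵥ u) := by
  obtain ⟨l, hl, hw⟩ := exists_spectral_weights hA
  obtain ⟨w, hw0, hw⟩ := hw u
  have hwu : ∑ a, w a = u ⬝ᵥ u := by simpa using (hw 0).symm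
  have hla : ∀ a, |l a| ≤ 1 / 2 := by
    intro a
    by_contra! hlt
    have h1 : (1 / 4 : ℝ) ^ N ≤ l a ^ (2 * N) := by
      rw [pow_mul, ← sq_abs]
      exact pow_le_pow_left₀ (by norm_num) (by nlinarith) _
    have h2 : l a ^ (2 * N) ≤ ∑ a, l a ^ (2 * N) :=
      Finset.single_le_sum (f := fun a => l a ^ (2 * N))
        (fun b _ => (even_two_mul N).pow_nonneg _) (Finset.mem_univ a)
    rw [hl] at h
    linarith
  have h1 : u ⬝ᵥ (A *ᵥ u) = ∑ a, w a * l a := by simpa using hw 1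
  rw [h1, ← hwu, Finset.mul_sum]
  refine (Finset.abs_sum_le_sum_abs _ _).trans (Finset.sum_le_sum fun a _ => ?_)
  rw [abs_mul, abs_of_nonneg (hw0 a), mul_comm]
  exact mul_le_mul_of_nonneg_right (hla a) (hw0 a)

/-- Product weight of `ω` for independent Bernoulli(`p`) coordinates. -/
noncomputable def bernoulliWeight (p : ℝ) {ι : Type*} [Fintype ι] (ω : ι → Bool) : ℝ :=
  ∏ k, if ω k then p else 1 - p

theorem bernoulliWeight_nonneg {p : ℝ} (h0 : 0 ≤ p) (h1 : p ≤ 1) {ι : Type*} [Fintype ι]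
    (ω : ι → Bool) : 0 ≤ bernoulliWeight p ω :=
  Finset.prod_nonneg fun k _ => by split_ifs <;> linarith

theorem sum_prod_bool {ι : Type*} [Fintype ι] [DecidableEq ι] (f : ι → Bool → ℝ) :
    ∑ ω : ι → Bool, ∏ k, f k (ω k) = ∏ k, (f k true + f k false) := by
  have := Finset.prod_univ_sum (fun _ : ι => (Finset.univ : Finset Bool)) f
  rw [Fintype.piFinset_univ] at this
  simp only [Fintype.sum_bool] at this
  exact this.symm

theorem sum_bernoulliWeight (p : ℝ) {ι : Type*} [Fintype ι] [DecidableEq ι] :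
    ∑ ω : ι → Bool, bernoulliWeight p ω = 1 := by
  unfold bernoulliWeight
  rw [sum_prod_bool (fun _ b => if b then p else 1 - p)]
  simp

theorem sum_bernoulliWeight_insertNth (p : ℝ) {n : ℕ} (k : Fin (n + 1))
    (h : (Fin (n + 1) → Bool) → ℝ) :
    ∑ ω, bernoulliWeight p ω * h ω =
      ∑ ω : Fin n → Bool, bernoulliWeight p ω *
        (p * h (k.insertNth true ω) + (1 - p) * h (k.insertNth false ω)) := by
  have e := (Fin.insertNthEquiv (fun _ => Bool) k).sum_comp
    (fun ω => bernoulliWeight p ω * h ω)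
  rw [← e, Fintype.sum_prod_type, Fintype.sum_bool, ← Finset.sum_add_distrib]
  refine Finset.sum_congr rfl fun ω _ => ?_
  change bernoulliWeight p (k.insertNth true ω) * h (k.insertNth true ω) +
    bernoulliWeight p (k.insertNth false ω) * h (k.insertNth false ω) = _
  simp only [bernoulliWeight, Fin.prod_univ_succAbove _ k,
    Fin.insertNth_apply_same, Fin.insertNth_apply_succAbove, if_true,
    Bool.false_eq_true, if_false]
  ring

/-- Indicator of a Boolean as a real number. -/
def boolReal (b : Bool) : ℝ := if b then 1 else 0

/-- `∑ₖ (δₖ - p) c uₖ uₖᵀ`. -/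
noncomputable def centeredGram {n : ℕ} {ι : Type*} (p c : ℝ) (u : Fin n → ι → ℝ)
    (ω : Fin n → Bool) : Matrix ι ι ℝ :=
  ∑ k, ((boolReal (ω k) - p) * c) • vecMulVec (u k) (u k)

theorem centeredGram_transpose {n : ℕ} {ι : Type*} (p c : ℝ) (u : Fin n → ι → ℝ)
    (ω : Fin n → Bool) : (centeredGram p c u ω)ᵀ = centeredGram p c u ω := by
  simp [centeredGram, Matrix.transpose_sum, transpose_smul, transpose_vecMulVec]

theorem centeredGram_insertNth_sub {n : ℕ} {ι : Type*} (p c : ℝ) (u : Fin (n + 1) → ι → ℝ)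
    (k : Fin (n + 1)) (ω : Fin n → Bool) :
    centeredGram p c u (k.insertNth true ω) - centeredGram p c u (k.insertNth false ω) =
      c • vecMulVec (u k) (u k) := by
  simp only [centeredGram, Fin.sum_univ_succAbove _ k, Fin.insertNth_apply_same,
    Fin.insertNth_apply_succAbove, add_sub_add_right_eq_sub, ← sub_smul]
  congr 1
  simp only [boolReal, if_true, Bool.false_eq_true, if_false]
  ring

theorem dotProduct_pow_mulVec_nonneg {ι : Type*} [Fintype ι] [DecidableEq ι]
    {A : Matrix ι ι ℝ} (hA : Aᵀ = A) {s : ℕ} (hs : Even s) (u : ι → ℝ) :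
    0 ≤ u ⬝ᵥ (A ^ s *ᵥ u) := by
  obtain ⟨l, -, hw⟩ := exists_spectral_weights hA
  obtain ⟨w, hw0, hw⟩ := hw u
  rw [hw]
  exact Finset.sum_nonneg fun a _ => mul_nonneg (hw0 a) (hs.pow_nonneg _)

theorem trace_vecMulVec_mul {ι : Type*} [Fintype ι] [DecidableEq ι] (u : ι → ℝ)
    (A : Matrix ι ι ℝ) : (vecMulVec u u * A).trace = u ⬝ᵥ (A *ᵥ u) := by
  rw [Matrix.trace_mul_comm, mul_vecMulVec, trace_vecMulVec, dotProduct_comm]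

theorem expect_centered_dotProduct_pow_le {n : ℕ} {ι : Type*} [Fintype ι] [DecidableEq ι]
    {p c r : ℝ} (h0 : 0 ≤ p) (h1 : p ≤ 1) (hc : 0 ≤ c) (u : Fin n → ι → ℝ)
    (hr : ∀ k, c * (u k ⬝ᵥ u k) ≤ r) {s : ℕ} (hs : Even s) (k : Fin n) :
    ∑ ω, bernoulliWeight p ω *
        ((boolReal (ω k) - p) * (u k ⬝ᵥ (centeredGram p c u ω ^ (s + 1) *ᵥ u k))) ≤
      ((s : ℝ) + 1) / 2 * r * ∑ ω, bernoulliWeight p ω *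
        ((boolReal (ω k) + p) * (u k ⬝ᵥ (centeredGram p c u ω ^ s *ᵥ u k))) := by
  obtain _ | n := n
  · exact k.elim0
  rw [sum_bernoulliWeight_insertNth p k, sum_bernoulliWeight_insertNth p k, Finset.mul_sum]
  refine Finset.sum_le_sum fun ω _ => ?_
  rw [mul_left_comm (((s : ℝ) + 1) / 2 * r)]
  refine mul_le_mul_of_nonneg_left ?_ (bernoulliWeight_nonneg h0 h1 ω)
  have key := dotProduct_pow_sub_pow_le (centeredGram_transpose p c u (k.insertNth true ω))
    (centeredGram_transpose p c u (k.insertNth false ω)) hc (u k)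
    (centeredGram_insertNth_sub p c u k ω) hs
  have p1 := dotProduct_pow_mulVec_nonneg
    (centeredGram_transpose p c u (k.insertNth true ω)) hs (u k)
  have p0 := dotProduct_pow_mulVec_nonneg
    (centeredGram_transpose p c u (k.insertNth false ω)) hs (u k)
  simp only [Fin.insertNth_apply_same, boolReal, if_true, Bool.false_eq_true, if_false]
  set g1 := u k ⬝ᵥ (centeredGram p c u (k.insertNth true ω) ^ (s + 1) *ᵥ u k)
  set g0 := u k ⬝ᵥ (centeredGram p c u (k.insertNth false ω) ^ (s + 1) *ᵥ u k)
  set q1 := u k ⬝ᵥ (centeredGram p c u (k.insertNth true ω) ^ s *ᵥ u k)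
  set q0 := u k ⬝ᵥ (centeredGram p c u (k.insertNth false ω) ^ s *ᵥ u k)
  have hr0 : 0 ≤ r := le_trans (mul_nonneg hc (by
    simpa using dotProduct_star_self_nonneg (u k))) (hr k)
  have hS : (0 : ℝ) ≤ ((s : ℝ) + 1) / 2 := by positivity
  have key2 : g1 - g0 ≤ ((s : ℝ) + 1) / 2 * r * (q1 + q0) :=
    key.trans (mul_le_mul_of_nonneg_right (mul_le_mul_of_nonneg_left (hr k) hS) (by linarith))
  have hR : 0 ≤ ((s : ℝ) + 1) / 2 * r := mul_nonneg hS hr0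
  set R := ((s : ℝ) + 1) / 2 * r
  have hpp : 0 ≤ p * (1 - p) := mul_nonneg h0 (by linarith)
  have e1 := mul_le_mul_of_nonneg_left key2 hpp
  have e2 : 0 ≤ p * p * (R * q1) := mul_nonneg (mul_nonneg h0 h0) (mul_nonneg hR p1)
  have e3 : 0 ≤ p * (R * q1) := mul_nonneg h0 (mul_nonneg hR p1)
  nlinarith

theorem sum_expect_trace_pow_le {n : ℕ} {ι : Type*} [Fintype ι] [DecidableEq ι]
    {p c r : ℝ} (h0 : 0 ≤ p) (h1 : p ≤ 1) (hc : 0 ≤ c) (u : Fin n → ι → ℝ)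
    (hr : ∀ k, c * (u k ⬝ᵥ u k) ≤ r)
    (hu : ∑ k, (p * c) • vecMulVec (u k) (u k) = 1) {s : ℕ} (hs : Even s) :
    ∑ ω, bernoulliWeight p ω * (centeredGram p c u ω ^ (s + 2)).trace ≤
      ((s : ℝ) + 1) / 2 * r * (2 * ∑ ω, bernoulliWeight p ω * (centeredGram p c u ω ^ s).trace +
        ∑ ω, bernoulliWeight p ω * (centeredGram p c u ω ^ (s + 1)).trace) := by
  have hL : ∀ ω, (centeredGram p c u ω ^ (s + 2)).trace = ∑ k, c * ((boolReal (ω k) - p) *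
      (u k ⬝ᵥ (centeredGram p c u ω ^ (s + 1) *ᵥ u k))) := by
    intro ω
    rw [show s + 2 = (s + 1) + 1 by ring, pow_succ' _ (s + 1)]
    conv_lhs => enter [1, 1]; rw [centeredGram]
    rw [Finset.sum_mul, Matrix.trace_sum]
    refine Finset.sum_congr rfl fun k _ => ?_
    rw [smul_mul, trace_smul, trace_vecMulVec_mul, smul_eq_mul]
    ring
  have hR : ∀ ω, 2 * (centeredGram p c u ω ^ s).trace + (centeredGram p c u ω ^ (s + 1)).trace =
      ∑ k, c * ((boolReal (ω k) + p) * (u k ⬝ᵥ (centeredGram p c u ω ^ s *ᵥ u k))) := by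
    intro ω
    have e1 : (centeredGram p c u ω ^ (s + 1)).trace = ∑ k, c * ((boolReal (ω k) - p) *
        (u k ⬝ᵥ (centeredGram p c u ω ^ s *ᵥ u k))) := by
      rw [pow_succ' _ s]
      conv_lhs => enter [1, 1]; rw [centeredGram]
      rw [Finset.sum_mul, Matrix.trace_sum]
      refine Finset.sum_congr rfl fun k _ => ?_
      rw [smul_mul, trace_smul, trace_vecMulVec_mul, smul_eq_mul]
      ring
    have e2 : (centeredGram p c u ω ^ s).trace = ∑ k, p * c *
        (u k ⬝ᵥ (centeredGram p c u ω ^ s *ᵥ u k)) := by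
      conv_lhs => rw [← Matrix.one_mul (centeredGram p c u ω ^ s), ← hu]
      rw [Finset.sum_mul, Matrix.trace_sum]
      refine Finset.sum_congr rfl fun k _ => ?_
      rw [smul_mul, trace_smul, trace_vecMulVec_mul, smul_eq_mul]
    rw [e1, e2, Finset.mul_sum, ← Finset.sum_add_distrib]
    exact Finset.sum_congr rfl fun k _ => by ring
  have hR' : 2 * ∑ ω, bernoulliWeight p ω * (centeredGram p c u ω ^ s).trace +
        ∑ ω, bernoulliWeight p ω * (centeredGram p c u ω ^ (s + 1)).trace =
      ∑ ω, bernoulliWeight p ω *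
        (2 * (centeredGram p c u ω ^ s).trace + (centeredGram p c u ω ^ (s + 1)).trace) := by
    rw [Finset.mul_sum, ← Finset.sum_add_distrib]
    exact Finset.sum_congr rfl fun ω _ => by ring
  have swap : ∀ f : (Fin n → Bool) → Fin n → ℝ,
      ∑ ω, bernoulliWeight p ω * ∑ k, c * f ω k = c * ∑ k, ∑ ω, bernoulliWeight p ω * f ω k := by
    intro f
    rw [Finset.sum_comm, Finset.mul_sum]
    refine Finset.sum_congr rfl fun ω _ => ?_
    rw [Finset.mul_sum, Finset.mul_sum]
    exact Finset.sum_congr rfl fun k _ => by ring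
  rw [hR']
  simp only [hL, hR, swap]
  rw [mul_left_comm]
  refine mul_le_mul_of_nonneg_left ?_ hc
  rw [Finset.mul_sum]
  exact Finset.sum_le_sum fun k _ => expect_centered_dotProduct_pow_le h0 h1 hc u hr hs k

theorem two_mul_trace_pow_odd_le {ι : Type*} [Fintype ι] [DecidableEq ι]
    {A : Matrix ι ι ℝ} (hA : Aᵀ = A) {s : ℕ} (hs : Even s) :
    2 * (A ^ (s + 1)).trace ≤ (A ^ s).trace + (A ^ (s + 2)).trace := by
  obtain ⟨l, hl, -⟩ := exists_spectral_weights hA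
  rw [hl, hl, hl, Finset.mul_sum, ← Finset.sum_add_distrib]
  refine Finset.sum_le_sum fun a _ => ?_
  have := mul_nonneg (hs.pow_nonneg (l a)) (sq_nonneg (l a - 1))
  rw [pow_succ, pow_add]
  nlinarith

theorem trace_even_pow_nonneg {ι : Type*} [Fintype ι] [DecidableEq ι]
    {A : Matrix ι ι ℝ} (hA : Aᵀ = A) {s : ℕ} (hs : Even s) : 0 ≤ (A ^ s).trace := by
  obtain ⟨l, hl, -⟩ := exists_spectral_weights hA
  rw [hl]
  exact Finset.sum_nonneg fun a _ => hs.pow_nonneg _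

theorem expect_trace_pow_le {n : ℕ} {ι : Type*} [Fintype ι] [DecidableEq ι]
    {p c r ρ : ℝ} (h0 : 0 ≤ p) (h1 : p ≤ 1) (hc : 0 ≤ c) (hr0 : 0 ≤ r) (u : Fin n → ι → ℝ)
    (hr : ∀ k, c * (u k ⬝ᵥ u k) ≤ r)
    (hu : ∑ k, (p * c) • vecMulVec (u k) (u k) = 1) (hρ : ρ ≤ 1) (N : ℕ)
    (hN : 2 * N * r ≤ ρ) :
    ∑ ω, bernoulliWeight p ω * (centeredGram p c u ω ^ (2 * N)).trace ≤
      (2 * ρ) ^ N * Fintype.card ι := by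
  induction N with
  | zero => simp [← Finset.sum_mul, sum_bernoulliWeight]
  | succ N ih =>
    push_cast at hN
    have hρ0 : 0 ≤ ρ := le_trans (by positivity) hN
    have ih' := ih (by nlinarith)
    have key := sum_expect_trace_pow_le h0 h1 hc u hr hu (even_two_mul N)
    have hodd : 2 * ∑ ω, bernoulliWeight p ω * (centeredGram p c u ω ^ (2 * N + 1)).trace ≤
        ∑ ω, bernoulliWeight p ω * (centeredGram p c u ω ^ (2 * N)).trace +
        ∑ ω, bernoulliWeight p ω * (centeredGram p c u ω ^ (2 * N + 2)).trace := by
      rw [Finset.mul_sum, ← Finset.sum_add_distrib]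
      refine Finset.sum_le_sum fun ω _ => ?_
      have := mul_le_mul_of_nonneg_left (two_mul_trace_pow_odd_le
        (centeredGram_transpose p c u ω) (even_two_mul N)) (bernoulliWeight_nonneg h0 h1 ω)
      linarith
    have hpos : ∀ M : ℕ,
        0 ≤ ∑ ω, bernoulliWeight p ω * (centeredGram p c u ω ^ (2 * M)).trace := by
      intro M
      refine Finset.sum_nonneg fun ω _ => mul_nonneg (bernoulliWeight_nonneg h0 h1 ω)
        (trace_even_pow_nonneg (centeredGram_transpose p c u ω) (even_two_mul M))
    have a0 := hpos N
    have a1 := hpos (N + 1)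
    rw [show 2 * (N + 1) = 2 * N + 2 by ring] at *
    set a := ∑ ω, bernoulliWeight p ω * (centeredGram p c u ω ^ (2 * N)).trace
    set b := ∑ ω, bernoulliWeight p ω * (centeredGram p c u ω ^ (2 * N + 1)).trace
    set d := ∑ ω, bernoulliWeight p ω * (centeredGram p c u ω ^ (2 * N + 2)).trace
    push_cast at key
    have hR : (2 * (N : ℝ) + 1) / 2 * r ≤ ρ / 2 := by nlinarith
    have hR0 : 0 ≤ (2 * (N : ℝ) + 1) / 2 * r := by positivity
    have k2 : d ≤ ρ / 2 * (5 / 2 * a + d / 2) :=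
      key.trans ((mul_le_mul_of_nonneg_left (by linarith) hR0).trans
        (mul_le_mul_of_nonneg_right hR (by positivity)))
    have k3 : d ≤ 2 * ρ * a := by nlinarith
    calc d ≤ 2 * ρ * a := k3
      _ ≤ 2 * ρ * ((2 * ρ) ^ N * Fintype.card ι) :=
        mul_le_mul_of_nonneg_left ih' (by positivity)
      _ = _ := by ring

theorem exp_le_one_add_add_sq {u : ℝ} (hu : |u| ≤ 1) : exp u ≤ 1 + u + u ^ 2 := by
  have := (abs_le.1 (Real.abs_exp_sub_one_sub_id_le hu)).2
  linarith

theorem bernoulli_exp_quadratic_le {p x y : ℝ} (h0 : 0 ≤ p) (h1 : p ≤ 1) (hx : |x| ≤ 1 / 2)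
    (hy0 : 0 ≤ y) (hy : y ≤ 1 / 2) :
    p * exp ((1 - p) * x + (1 - p) ^ 2 * y) + (1 - p) * exp (-p * x + p ^ 2 * y) ≤
      exp (2 * p * x ^ 2 + 2 * p * y) := by
  have hq : 0 ≤ 1 - p := by linarith
  obtain ⟨hx1, hx2⟩ := abs_le.1 hx
  have small : ∀ t : ℝ, |t| ≤ 1 → |t * x + t ^ 2 * y| ≤ 1 := by
    intro t ht
    have e1 : |t * x| ≤ 1 / 2 := by
      rw [abs_mul]; nlinarith [abs_nonneg x, abs_nonneg t]
    have e2 : |t ^ 2 * y| ≤ 1 / 2 := by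
      rw [abs_mul, abs_of_nonneg hy0, abs_pow]
      nlinarith [abs_nonneg t, sq_nonneg |t|]
    linarith [abs_add_le (t * x) (t ^ 2 * y)]
  have e1 := exp_le_one_add_add_sq (small (1 - p) (abs_le.2 ⟨by linarith, by linarith⟩))
  have e2 := exp_le_one_add_add_sq (small (-p) (abs_le.2 ⟨by linarith, by linarith⟩))
  rw [neg_sq] at e2
  have e3 := Real.add_one_le_exp (2 * p * x ^ 2 + 2 * p * y)
  have s1 : ((1 - p) * x + (1 - p) ^ 2 * y) ^ 2 ≤ (1 - p) ^ 2 * (2 * x ^ 2 + 2 * y ^ 2) := by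
    have : ((1 - p) * x + (1 - p) ^ 2 * y) ^ 2 = (1 - p) ^ 2 * (x + (1 - p) * y) ^ 2 := by ring
    rw [this]
    refine mul_le_mul_of_nonneg_left ?_ (sq_nonneg _)
    have h3 : ((1 - p) * y) ^ 2 ≤ y ^ 2 := pow_le_pow_left₀ (by positivity) (by nlinarith) 2
    nlinarith [sq_nonneg (x - (1 - p) * y)]
  have s2 : (-p * x + p ^ 2 * y) ^ 2 ≤ p ^ 2 * (2 * x ^ 2 + 2 * y ^ 2) := by
    have : (-p * x + p ^ 2 * y) ^ 2 = p ^ 2 * (-x + p * y) ^ 2 := by ring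
    rw [this]
    refine mul_le_mul_of_nonneg_left ?_ (sq_nonneg _)
    have h3 : (p * y) ^ 2 ≤ y ^ 2 := pow_le_pow_left₀ (by positivity) (by nlinarith) 2
    nlinarith [sq_nonneg (x + p * y)]
  have hyy : 2 * y ^ 2 ≤ y := by nlinarith
  have t1 := mul_le_mul_of_nonneg_left (e1.trans (add_le_add_right s1 _)) h0
  have t2 := mul_le_mul_of_nonneg_left (e2.trans (add_le_add_right s2 _)) hq
  have t3 : p * (1 - p) * (2 * x ^ 2 + 2 * y ^ 2) ≤ p * (2 * x ^ 2 + y) := by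
    rw [mul_assoc]
    refine mul_le_mul_of_nonneg_left ?_ h0
    nlinarith [sq_nonneg x, sq_nonneg y]
  have t4 : p * (1 - p) * y ≤ p * y := by
    rw [mul_assoc]
    exact mul_le_mul_of_nonneg_left (by nlinarith) h0
  nlinarith

theorem dotProduct_sq_le {ι : Type*} [Fintype ι] (x y : ι → ℝ) :
    (x ⬝ᵥ y) ^ 2 ≤ (x ⬝ᵥ x) * (y ⬝ᵥ y) := by
  have := Finset.sum_mul_sq_le_sq_mul_sq Finset.univ x y
  simpa [dotProduct, sq] using this

theorem dotProduct_self_nonneg' {ι : Type*} [Fintype ι] (x : ι → ℝ) : 0 ≤ x ⬝ᵥ x :=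
  Finset.sum_nonneg fun i _ => mul_self_nonneg (x i)

/-- Quadratic forms bounded below by `a ‖x‖²` give `‖y‖² ≤ ‖S y‖² / a²`. -/
theorem sq_mul_dotProduct_self_le {ι : Type*} [Fintype ι] {S : Matrix ι ι ℝ} {a : ℝ} (ha : 0 ≤ a)
    (hS : ∀ x, a * (x ⬝ᵥ x) ≤ x ⬝ᵥ (S *ᵥ x)) (y : ι → ℝ) :
    a ^ 2 * (y ⬝ᵥ y) ≤ (S *ᵥ y) ⬝ᵥ (S *ᵥ y) := by
  have h1 := hS y
  have h2 := dotProduct_sq_le y (S *ᵥ y)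
  have h3 := dotProduct_self_nonneg' y
  have h4 := dotProduct_self_nonneg' (S *ᵥ y)
  rcases h3.eq_or_lt with h | h
  · rw [← h]; simpa using h4
  · have h5 : (a * (y ⬝ᵥ y)) ^ 2 ≤ (y ⬝ᵥ y) * ((S *ᵥ y) ⬝ᵥ (S *ᵥ y)) :=
      (pow_le_pow_left₀ (mul_nonneg ha h3) h1 2).trans h2
    by_contra! hlt
    have := mul_lt_mul_of_pos_left hlt h
    nlinarith

theorem exists_mulVec_eq {ι : Type*} [Fintype ι] [DecidableEq ι] {S : Matrix ι ι ℝ} {a : ℝ}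
    (ha : 0 < a) (hS : ∀ x, a * (x ⬝ᵥ x) ≤ x ⬝ᵥ (S *ᵥ x)) (w : ι → ℝ) : ∃ y, S *ᵥ y = w := by
  have hinj : Function.Injective S.mulVec := by
    intro x y hxy
    have h0 : S *ᵥ (x - y) = 0 := by rw [mulVec_sub]; exact sub_eq_zero.2 hxy
    have := sq_mul_dotProduct_self_le ha.le hS (x - y)
    rw [h0, dotProduct_zero] at this
    have h2 : (x - y) ⬝ᵥ (x - y) = 0 :=
      le_antisymm (by by_contra! h; nlinarith [mul_pos (pow_pos ha 2) h])
        (dotProduct_self_nonneg' _)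
    exact sub_eq_zero.1 (dotProduct_self_eq_zero.1 h2)
  exact mulVec_surjective_iff_isUnit.2 (mulVec_injective_iff_isUnit.1 hinj) w

/-- The matrix `t⁻¹ - 8p ∑ₖ bₖ bₖᵀ`, whose inverse solves a discrete Riccati recursion. -/
noncomputable def riccatiMatrix {ι : Type*} [DecidableEq ι] (p t : ℝ) {n : ℕ}
    (b : Fin n → ι → ℝ) : Matrix ι ι ℝ :=
  t⁻¹ • (1 : Matrix ι ι ℝ) - ∑ k, (8 * p) • vecMulVec (b k) (b k)

theorem dotProduct_riccatiMatrix {ι : Type*} [Fintype ι] [DecidableEq ι] (p t : ℝ) {n : ℕ}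
    (b : Fin n → ι → ℝ) (x y : ι → ℝ) :
    x ⬝ᵥ (riccatiMatrix p t b *ᵥ y) =
      t⁻¹ * (x ⬝ᵥ y) - 8 * p * ∑ k, (b k ⬝ᵥ x) * (b k ⬝ᵥ y) := by
  rw [riccatiMatrix, sub_mulVec, dotProduct_sub, smul_mulVec, one_mulVec, dotProduct_smul,
    Matrix.sum_mulVec, dotProduct_sum, Finset.mul_sum, smul_eq_mul]
  congr 1
  refine Finset.sum_congr rfl fun k _ => ?_
  rw [smul_mulVec, vecMulVec_mulVec, op_smul_eq_smul, dotProduct_smul, dotProduct_smul,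
    dotProduct_comm x (b k)]
  simp only [smul_eq_mul]
  ring

theorem two_mul_dotProduct_sub_le {ι : Type*} [Fintype ι] {S : Matrix ι ι ℝ}
    (hS : ∀ x, 0 ≤ x ⬝ᵥ (S *ᵥ x)) (hsymm : ∀ x y, x ⬝ᵥ (S *ᵥ y) = y ⬝ᵥ (S *ᵥ x))
    (y z : ι → ℝ) :
    2 * (z ⬝ᵥ (S *ᵥ y)) - z ⬝ᵥ (S *ᵥ z) ≤ y ⬝ᵥ (S *ᵥ y) := by
  have := hS (y - z)
  rw [mulVec_sub, sub_dotProduct, dotProduct_sub, dotProduct_sub, hsymm y z] at this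
  linarith

theorem tail_sum_centered_le {ι : Type*} [Fintype ι] [DecidableEq ι] {p t τ : ℝ}
    (h0 : 0 ≤ p) (h1 : p ≤ 1) (ht : 0 < t) :
    ∀ (n : ℕ) (b : Fin n → ι → ℝ), (∀ k, t * (b k ⬝ᵥ b k) ≤ 1 / 4) →
      (∀ k, 64 * t ^ 2 * τ * (b k ⬝ᵥ b k) ≤ 1) →
      (∀ x : ι → ℝ, 8 * p * ∑ k, (b k ⬝ᵥ x) ^ 2 ≤ (2 * t)⁻¹ * (x ⬝ᵥ x)) →
      ∀ w y : ι → ℝ, riccatiMatrix p t b *ᵥ y = w →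
        ∑ ω, bernoulliWeight p ω *
          (if τ < (w + ∑ k, (boolReal (ω k) - p) • b k) ⬝ᵥ
              (w + ∑ k, (boolReal (ω k) - p) • b k) then 1 else 0) ≤
          exp (y ⬝ᵥ w + 4 * t * p * ∑ k, b k ⬝ᵥ b k - t * τ) := by
  have hsymm : ∀ (n : ℕ) (b : Fin n → ι → ℝ) (x y : ι → ℝ),
      x ⬝ᵥ (riccatiMatrix p t b *ᵥ y) = y ⬝ᵥ (riccatiMatrix p t b *ᵥ x) := by
    intro n b x y
    rw [dotProduct_riccatiMatrix, dotProduct_riccatiMatrix, dotProduct_comm x y]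
    simp only [mul_comm]
  have hlow : ∀ (n : ℕ) (b : Fin n → ι → ℝ),
      (∀ x : ι → ℝ, 8 * p * ∑ k, (b k ⬝ᵥ x) ^ 2 ≤ (2 * t)⁻¹ * (x ⬝ᵥ x)) →
      ∀ x, (2 * t)⁻¹ * (x ⬝ᵥ x) ≤ x ⬝ᵥ (riccatiMatrix p t b *ᵥ x) := by
    intro n b hb x
    rw [dotProduct_riccatiMatrix]
    have e : t⁻¹ = 2 * (2 * t)⁻¹ := by field_simp
    have := hb x
    simp only [sq] at this
    rw [e]
    linarith
  have ha : 0 < (2 * t)⁻¹ := by positivity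
  intro n
  induction n with
  | zero =>
    intro b _ _ hb w y hy
    by_cases hw : τ < w ⬝ᵥ w
    · have : y = t • w := by
        rw [← hy]
        simp [riccatiMatrix, smul_mulVec, smul_smul, ht.ne']
      simp only [Finset.univ_eq_empty, Finset.sum_empty, add_zero, hw, if_true, mul_one, this,
        sum_bernoulliWeight, smul_dotProduct, smul_eq_mul, mul_zero]
      rw [← mul_sub]
      exact Real.one_le_exp (mul_nonneg ht.le (by linarith))
    · simp [hw, Real.exp_nonneg]
  | succ n ih =>
    intro b hb1 hb2 hb w y hy
    by_cases hw : τ < w ⬝ᵥ w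
    · have hyw : t * (w ⬝ᵥ w) ≤ y ⬝ᵥ w := by
        have h2 := two_mul_dotProduct_sub_le (fun x =>
          (mul_nonneg ha.le (dotProduct_self_nonneg' x)).trans (hlow _ b hb x))
          (hsymm _ b) y (t • w)
        rw [hy, dotProduct_riccatiMatrix] at h2
        simp only [smul_dotProduct, dotProduct_smul, smul_eq_mul] at h2
        have h3 : 0 ≤ 8 * p * ∑ k, t * (b k ⬝ᵥ w) * (t * (b k ⬝ᵥ w)) :=
          mul_nonneg (by positivity) (Finset.sum_nonneg fun k _ => mul_self_nonneg _)
        have h4 : t⁻¹ * (t * (t * (w ⬝ᵥ w))) = t * (w ⬝ᵥ w) := by field_simp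
        linarith
      have h5 : (1 : ℝ) ≤ exp (y ⬝ᵥ w + 4 * t * p * ∑ k, b k ⬝ᵥ b k - t * τ) := by
        refine Real.one_le_exp ?_
        have : 0 ≤ 4 * t * p * ∑ k, b k ⬝ᵥ b k :=
          mul_nonneg (by positivity) (Finset.sum_nonneg fun k _ => dotProduct_self_nonneg' _)
        nlinarith
      refine (Finset.sum_le_sum (g := bernoulliWeight p) fun ω _ => ?_).trans
        ((sum_bernoulliWeight p).trans_le h5)
      have := bernoulliWeight_nonneg h0 h1 ω
      split_ifs <;> simp [this]
    · push Not at hw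
      set b' : Fin n → ι → ℝ := fun k => b ((0 : Fin (n + 1)).succAbove k) with hb'
      have hbt : ∀ x : ι → ℝ, 8 * p * ∑ k, (b' k ⬝ᵥ x) ^ 2 ≤ (2 * t)⁻¹ * (x ⬝ᵥ x) := by
        intro x
        refine le_trans ?_ (hb x)
        rw [Fin.sum_univ_succAbove _ 0]
        exact mul_le_mul_of_nonneg_left (le_add_of_nonneg_left (sq_nonneg _)) (by positivity)
      have hl := hlow n b' hbt
      obtain ⟨y', hy'⟩ := exists_mulVec_eq ha hl w
      obtain ⟨g, hg⟩ := exists_mulVec_eq ha hl (b 0)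
      have hgw : g ⬝ᵥ w = y' ⬝ᵥ b 0 := by rw [← hy', hsymm, hg]
      have step : ∀ ξ : ℝ, ∑ ω, bernoulliWeight p ω *
          (if τ < ((w + ξ • b 0) + ∑ k, (boolReal (ω k) - p) • b' k) ⬝ᵥ
              ((w + ξ • b 0) + ∑ k, (boolReal (ω k) - p) • b' k) then 1 else 0) ≤
          exp (y' ⬝ᵥ w + 4 * t * p * ∑ k, b' k ⬝ᵥ b' k - t * τ) *
            exp (ξ * (2 * (y' ⬝ᵥ b 0)) + ξ ^ 2 * (g ⬝ᵥ b 0)) := by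
        intro ξ
        refine (ih b' (fun k => hb1 _) (fun k => hb2 _) hbt (w + ξ • b 0) (y' + ξ • g)
          (by rw [mulVec_add, mulVec_smul, hy', hg])).trans_eq ?_
        rw [← Real.exp_add]
        congr 1
        simp only [add_dotProduct, dotProduct_add, smul_dotProduct, dotProduct_smul, smul_eq_mul,
          hgw]
        ring
      have hb00 := dotProduct_self_nonneg' (b 0)
      have t2 : ((2 * t)⁻¹) ^ 2 = (4 * t ^ 2)⁻¹ := by rw [inv_pow]; ring
      have ny : y' ⬝ᵥ y' ≤ 4 * t ^ 2 * (w ⬝ᵥ w) := by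
        have := sq_mul_dotProduct_self_le ha.le hl y'
        rw [hy', t2, inv_mul_le_iff₀ (by positivity)] at this
        exact this
      have ng : g ⬝ᵥ g ≤ 4 * t ^ 2 * (b 0 ⬝ᵥ b 0) := by
        have := sq_mul_dotProduct_self_le ha.le hl g
        rw [hg, t2, inv_mul_le_iff₀ (by positivity)] at this
        exact this
      have hx : |2 * (y' ⬝ᵥ b 0)| ≤ 1 / 2 := by
        refine abs_le_of_sq_le_sq ?_ (by norm_num)
        have c1 := dotProduct_sq_le y' (b 0)
        have c2 : (y' ⬝ᵥ y') * (b 0 ⬝ᵥ b 0) ≤ 4 * t ^ 2 * τ * (b 0 ⬝ᵥ b 0) :=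
          mul_le_mul_of_nonneg_right (ny.trans (mul_le_mul_of_nonneg_left hw (by positivity))) hb00
        have c3 := hb2 0
        nlinarith
      have hY0 : 0 ≤ g ⬝ᵥ b 0 := by
        rw [← hg]
        exact (mul_nonneg ha.le (dotProduct_self_nonneg' g)).trans (hl g)
      have hY : g ⬝ᵥ b 0 ≤ 2 * t * (b 0 ⬝ᵥ b 0) := by
        refine le_of_sq_le_sq ?_ (by positivity)
        calc _ ≤ _ := dotProduct_sq_le g (b 0)
          _ ≤ 4 * t ^ 2 * (b 0 ⬝ᵥ b 0) * (b 0 ⬝ᵥ b 0) := mul_le_mul_of_nonneg_right ng hb00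
          _ = _ := by ring
      have hmgf := bernoulli_exp_quadratic_le h0 h1 hx hY0 (by linarith [hb1 0])
      have hyw : y' ⬝ᵥ w + 8 * p * (y' ⬝ᵥ b 0) ^ 2 ≤ y ⬝ᵥ w := by
        have h2 := two_mul_dotProduct_sub_le (fun x =>
          (mul_nonneg ha.le (dotProduct_self_nonneg' x)).trans (hlow _ b hb x))
          (hsymm _ b) y y'
        have h3 : y' ⬝ᵥ (riccatiMatrix p t b *ᵥ y') =
            y' ⬝ᵥ w - 8 * p * (y' ⬝ᵥ b 0) ^ 2 := by
          rw [← hy', dotProduct_riccatiMatrix, dotProduct_riccatiMatrix,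
            Fin.sum_univ_succAbove _ 0, dotProduct_comm y' (b 0)]
          ring
        rw [h3, hy] at h2
        linarith
      rw [sum_bernoulliWeight_insertNth p 0]
      simp only [Fin.sum_univ_succAbove _ (0 : Fin (n + 1)), Fin.insertNth_apply_same,
        Fin.insertNth_apply_succAbove, ← add_assoc, mul_add, Finset.sum_add_distrib]
      have s1 := mul_le_mul_of_nonneg_left (step (1 - p)) h0
      have s2 := mul_le_mul_of_nonneg_left (step (-p)) (sub_nonneg.2 h1)
      rw [Finset.mul_sum] at s1 s2
      have bt : boolReal true = 1 := rfl
      have bf : boolReal false = 0 := rfl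
      simp only [bt, bf, zero_sub]
      refine le_trans (add_le_add (le_of_eq_of_le ?_ s1) (le_of_eq_of_le ?_ s2)) ?_
      · exact Finset.sum_congr rfl fun ω _ => by ring
      · exact Finset.sum_congr rfl fun ω _ => by ring
      set E := exp (y' ⬝ᵥ w + 4 * t * p * ∑ k, b' k ⬝ᵥ b' k - t * τ) with hE
      calc _ = E * (p * exp ((1 - p) * (2 * (y' ⬝ᵥ b 0)) + (1 - p) ^ 2 * (g ⬝ᵥ b 0)) +
            (1 - p) * exp (-p * (2 * (y' ⬝ᵥ b 0)) + p ^ 2 * (g ⬝ᵥ b 0))) := by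
              rw [neg_sq]; ring
        _ ≤ E * exp (2 * p * (2 * (y' ⬝ᵥ b 0)) ^ 2 + 2 * p * (g ⬝ᵥ b 0)) :=
          mul_le_mul_of_nonneg_left hmgf (Real.exp_nonneg _)
        _ ≤ _ := by
          rw [hE, ← Real.exp_add, Real.exp_le_exp]
          have := mul_le_mul_of_nonneg_left hY h0
          linarith

theorem sum_exp_signs_le {ι : Type*} [Fintype ι] [DecidableEq ι] (w : ι → ℝ) :
    ∑ z : ι → Bool, (1 / 2 : ℝ) ^ Fintype.card ι *
        exp (∑ i, (if z i then 1 else -1) * w i) ≤ exp (w ⬝ᵥ w / 2) := by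
  have h : ∀ z : ι → Bool, (1 / 2 : ℝ) ^ Fintype.card ι *
      exp (∑ i, (if z i then 1 else -1) * w i) =
      ∏ i, (1 / 2 * exp ((if z i then 1 else -1) * w i)) := by
    intro z
    rw [Finset.prod_mul_distrib, Finset.prod_const, Finset.card_univ, Real.exp_sum]
  simp only [h]
  rw [sum_prod_bool (fun i b => 1 / 2 * exp ((if b then 1 else -1) * w i)), dotProduct,
    Finset.sum_div, Real.exp_sum]
  refine Finset.prod_le_prod (fun i _ => by positivity) fun i _ => ?_
  have := Real.cosh_le_exp_half_sq (w i)
  rw [Real.cosh_eq] at this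
  simp only [if_true, Bool.false_eq_true, if_false, one_mul, neg_mul]
  rw [← sq]
  linarith

theorem tail_signs_le {ι : Type*} [Fintype ι] [DecidableEq ι] {w : ι → ℝ} {τ : ℝ} (hτ : 0 < τ)
    (hw : w ⬝ᵥ w ≤ 4 * τ) :
    ∑ z : ι → Bool, (1 / 2 : ℝ) ^ Fintype.card ι *
        (if 1 ≤ |∑ i, (if z i then 1 else -1) * w i| then 1 else 0) ≤
      2 * exp (-(8 * τ)⁻¹) := by
  set s : ℝ := (4 * τ)⁻¹ with hs
  have hs0 : 0 < s := by positivity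
  have hexp : ∀ σ : ℝ, σ ^ 2 = s ^ 2 → ∑ z : ι → Bool, (1 / 2 : ℝ) ^ Fintype.card ι *
        exp (σ * ∑ i, (if z i then 1 else -1) * w i) ≤ exp (s / 2) := by
    intro σ hσ
    have h1 := sum_exp_signs_le (σ • w)
    simp only [Pi.smul_apply, smul_eq_mul, smul_dotProduct, dotProduct_smul] at h1
    refine le_trans (le_of_eq ?_) (h1.trans (Real.exp_le_exp.2 ?_))
    · refine Finset.sum_congr rfl fun z _ => ?_
      rw [Finset.mul_sum]
      congr 2
      exact Finset.sum_congr rfl fun i _ => by ring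
    · have h2 : s * (4 * τ) = 1 := inv_mul_cancel₀ (by positivity)
      have h3 : σ * (σ * (w ⬝ᵥ w)) ≤ s ^ 2 * (4 * τ) := by
        rw [← mul_assoc, ← sq, hσ]
        exact mul_le_mul_of_nonneg_left hw (sq_nonneg _)
      have h4 : s ^ 2 * (4 * τ) = s := by rw [sq, mul_assoc, h2, mul_one]
      linarith
  have hpt : ∀ x : ℝ, (if 1 ≤ |x| then (1 : ℝ) else 0) ≤
      exp (-s) * (exp (s * x) + exp (-s * x)) := by
    intro x
    split_ifs with hx
    · rw [mul_add, ← Real.exp_add, ← Real.exp_add]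
      rcases le_abs.1 hx with h | h
      · have : (1 : ℝ) ≤ exp (-s + s * x) := Real.one_le_exp (by nlinarith)
        linarith [Real.exp_pos (-s + -s * x)]
      · have : (1 : ℝ) ≤ exp (-s + -s * x) := Real.one_le_exp (by nlinarith)
        linarith [Real.exp_pos (-s + s * x)]
    · positivity
  calc _ ≤ ∑ z : ι → Bool, (1 / 2 : ℝ) ^ Fintype.card ι *
        (exp (-s) * (exp (s * ∑ i, (if z i then 1 else -1) * w i) +
          exp (-s * ∑ i, (if z i then 1 else -1) * w i))) :=
        Finset.sum_le_sum fun z _ => mul_le_mul_of_nonneg_left (hpt _) (by positivity)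
    _ = exp (-s) * (∑ z : ι → Bool, (1 / 2 : ℝ) ^ Fintype.card ι *
          exp (s * ∑ i, (if z i then 1 else -1) * w i) +
        ∑ z : ι → Bool, (1 / 2 : ℝ) ^ Fintype.card ι *
          exp (-s * ∑ i, (if z i then 1 else -1) * w i)) := by
        rw [← Finset.sum_add_distrib, Finset.mul_sum]
        exact Finset.sum_congr rfl fun z _ => by ring
    _ ≤ exp (-s) * (exp (s / 2) + exp (s / 2)) :=
        mul_le_mul_of_nonneg_left (add_le_add (hexp s rfl) (hexp (-s) (neg_sq s)))
          (Real.exp_nonneg _)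
    _ = 2 * exp (-(8 * τ)⁻¹) := by
        rw [← two_mul, mul_left_comm, ← Real.exp_add]
        congr 2
        rw [hs]
        field_simp
        norm_num

theorem l1_lt_of_dual_certificate {n : ℕ} {T : Finset (Fin n)} {Y x0 x : Fin n → ℝ}
    (hx0 : ∀ t, t ∉ T → x0 t = 0) (hYT : ∀ t ∈ T, Real.sign (x0 t) = Y t)
    (hYc : ∀ t, t ∉ T → |Y t| < 1) (horth : Y ⬝ᵥ (x - x0) = 0)
    (hne : ∃ t, t ∉ T ∧ x t ≠ 0) :
    ∑ i, |x0 i| < ∑ i, |x i| := by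
  have hle : ∀ i, |x0 i| + Y i * (x i - x0 i) ≤ |x i| := by
    intro i
    by_cases hi : i ∈ T
    · rw [← hYT i hi]
      rcases lt_trichotomy (x0 i) 0 with h | h | h
      · rw [Real.sign_of_neg h, abs_of_neg h]; linarith [neg_abs_le (x i)]
      · rw [h]; simp
      · rw [Real.sign_of_pos h, abs_of_pos h]; linarith [le_abs_self (x i)]
    · rw [hx0 i hi, abs_zero, zero_add, sub_zero]
      refine (le_abs_self _).trans ?_
      rw [abs_mul]
      exact mul_le_of_le_one_left (abs_nonneg _) (hYc i hi).le
  obtain ⟨t, ht, hxt⟩ := hne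
  have hlt : |x0 t| + Y t * (x t - x0 t) < |x t| := by
    rw [hx0 t ht, abs_zero, zero_add, sub_zero]
    refine (le_abs_self _).trans_lt ?_
    rw [abs_mul]
    exact mul_lt_of_lt_one_left (abs_pos.2 hxt) (hYc t ht)
  have h := Finset.sum_lt_sum (fun i _ => hle i) ⟨t, Finset.mem_univ t, hlt⟩
  rw [Finset.sum_add_distrib] at h
  simp only [dotProduct, Pi.sub_apply] at horth
  linarith

/-- The `k`-th row of `U` restricted to the columns in `T`. -/
def rowOn {n : ℕ} (U : Matrix (Fin n) (Fin n) ℝ) (T : Finset (Fin n)) (k : Fin n) : T → ℝ :=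
  fun i => U k i

theorem rowOn_apply {n : ℕ} (U : Matrix (Fin n) (Fin n) ℝ) (T : Finset (Fin n)) (k : Fin n)
    (i : T) : rowOn U T k i = U k i := rfl

/-- Every vector supported on `T` with signs `z` is the unique `ℓ₁` minimizer given the samples
selected by `ω`. -/
def ExactRecovery {n : ℕ} (U : Matrix (Fin n) (Fin n) ℝ) (T : Finset (Fin n)) (ω : Fin n → Bool)
    (z : T → Bool) : Prop :=
  ∀ x0 : Fin n → ℝ, (∀ t, t ∉ T → x0 t = 0) →
    (∀ t (ht : t ∈ T), Real.sign (x0 t) = (if z ⟨t, ht⟩ then 1 else -1)) →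
    ∀ x : Fin n → ℝ, (∀ k : Fin n, ω k = true → U.mulVec x k = U.mulVec x0 k) →
      x ≠ x0 → ∑ i, |x0 i| < ∑ i, |x i|

theorem mulVec_eq_rowOn_dotProduct {n : ℕ} {U : Matrix (Fin n) (Fin n) ℝ} {T : Finset (Fin n)}
    {h : Fin n → ℝ} (hT : ∀ t, t ∉ T → h t = 0) (k : Fin n) :
    (U *ᵥ h) k = rowOn U T k ⬝ᵥ fun i : T => h i := by
  simp only [mulVec, dotProduct, rowOn]
  rw [Finset.sum_coe_sort T (fun i => U k i * h i)]
  exact (Finset.sum_subset (Finset.subset_univ T) fun i _ hi => by rw [hT i hi, mul_zero]).symm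

theorem exactRecovery_of_gram {n : ℕ} {U : Matrix (Fin n) (Fin n) ℝ} {T : Finset (Fin n)}
    {ω : Fin n → Bool} {z : T → Bool} {c a : ℝ} (ha : 0 < a)
    (hM : ∀ x : T → ℝ, a * (x ⬝ᵥ x) ≤ x ⬝ᵥ
      ((∑ k, (boolReal (ω k) * c) • vecMulVec (rowOn U T k) (rowOn U T k)) *ᵥ x))
    (y : Fin n → T → ℝ)
    (hy : ∀ t, t ∉ T → (∑ k, (boolReal (ω k) * c) • vecMulVec (rowOn U T k) (rowOn U T k)) *ᵥ y t
      = ∑ k, (boolReal (ω k) * c * U k t) • rowOn U T k)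
    (hz : ∀ t, t ∉ T → |∑ i, (if z i then 1 else -1) * y t i| < 1) :
    ExactRecovery U T ω z := by
  set M := ∑ k, (boolReal (ω k) * c) • vecMulVec (rowOn U T k) (rowOn U T k) with hMdef
  have hMv : ∀ x, M *ᵥ x = ∑ k, (boolReal (ω k) * c * (rowOn U T k ⬝ᵥ x)) • rowOn U T k := by
    intro x
    rw [hMdef, Matrix.sum_mulVec]
    refine Finset.sum_congr rfl fun k _ => ?_
    rw [smul_mulVec, vecMulVec_mulVec, op_smul_eq_smul, smul_smul]
  intro x0 hx0 hsign x hx hne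
  obtain ⟨g, hg⟩ := exists_mulVec_eq ha hM (fun i => if z i then 1 else -1)
  set Y : Fin n → ℝ := fun j => ∑ k, boolReal (ω k) * c * U k j * (rowOn U T k ⬝ᵥ g) with hY
  have hker : ∀ k, boolReal (ω k) * (U *ᵥ (x - x0)) k = 0 := by
    intro k
    cases hk : ω k
    · simp [boolReal]
    · rw [mulVec_sub, Pi.sub_apply, hx k hk]; simp
  refine l1_lt_of_dual_certificate (Y := Y) hx0 ?_ ?_ ?_ ?_
  · intro t ht
    rw [hsign t ht]
    have := congrFun hg ⟨t, ht⟩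
    rw [hMv] at this
    simp only [Finset.sum_apply, Pi.smul_apply, smul_eq_mul, rowOn_apply] at this
    rw [← this, hY]
    exact Finset.sum_congr rfl fun k _ => by ring
  · intro t ht
    have e : Y t = ∑ i, (if z i then 1 else -1) * y t i := by
      have e1 : Y t = (∑ k, (boolReal (ω k) * c * U k t) • rowOn U T k) ⬝ᵥ g := by
        simp only [hY, sum_dotProduct, smul_dotProduct, smul_eq_mul]
      have e2 : (M *ᵥ y t) ⬝ᵥ g = (M *ᵥ g) ⬝ᵥ y t := by
        simp only [hMv, sum_dotProduct, smul_dotProduct, smul_eq_mul]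
        exact Finset.sum_congr rfl fun k _ => by ring
      rw [e1, ← hy t ht, e2, hg, dotProduct]
    rw [e]
    exact hz t ht
  · have : Y ⬝ᵥ (x - x0) =
        ∑ k, c * (rowOn U T k ⬝ᵥ g) * (boolReal (ω k) * (U *ᵥ (x - x0)) k) := by
      rw [hY, dotProduct]
      simp only [mulVec, Finset.sum_mul]
      rw [Finset.sum_comm]
      refine Finset.sum_congr rfl fun k _ => ?_
      rw [dotProduct.eq_1 (U k), Finset.mul_sum, Finset.mul_sum]
      exact Finset.sum_congr rfl fun j _ => by ring
    rw [this]
    simp [hker]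
  · by_contra! hsup
    apply hne
    have hT : ∀ t, t ∉ T → (x - x0) t = 0 := fun t ht => by simp [hsup t ht, hx0 t ht]
    have h0 : M *ᵥ (fun i : T => (x - x0) i) = 0 := by
      rw [hMv]
      refine Finset.sum_eq_zero fun k _ => ?_
      have := hker k
      rw [mulVec_eq_rowOn_dotProduct hT] at this
      rw [mul_right_comm, this, zero_mul, zero_smul]
    have h1 := hM (fun i : T => (x - x0) i)
    rw [h0, dotProduct_zero] at h1
    have h2 := dotProduct_self_nonneg' (fun i : T => (x - x0) i)
    have h3 := dotProduct_self_eq_zero.1 (le_antisymm (by by_contra! h; nlinarith [mul_pos ha h]) h2)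
    funext t
    by_cases ht : t ∈ T
    · exact sub_eq_zero.1 (congrFun h3 ⟨t, ht⟩)
    · exact sub_eq_zero.1 (hT t ht)

theorem sum_half_pow {ι : Type*} [Fintype ι] [DecidableEq ι] :
    ∑ _z : ι → Bool, (1 / 2 : ℝ) ^ Fintype.card ι = 1 := by
  simp

theorem one_sub_le_prob_signs_exactRecovery {n : ℕ} {U : Matrix (Fin n) (Fin n) ℝ}
    {T : Finset (Fin n)} {ω : Fin n → Bool} {c τ : ℝ} (hτ : 0 < τ)
    (hM : ∀ x : T → ℝ, 1 / 2 * (x ⬝ᵥ x) ≤ x ⬝ᵥ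
      ((∑ k, (boolReal (ω k) * c) • vecMulVec (rowOn U T k) (rowOn U T k)) *ᵥ x))
    (hv : ∀ t, t ∉ T → (∑ k, (boolReal (ω k) * c * U k t) • rowOn U T k) ⬝ᵥ
      (∑ k, (boolReal (ω k) * c * U k t) • rowOn U T k) ≤ τ) :
    1 - n * (2 * exp (-(8 * τ)⁻¹)) ≤ ∑ z : T → Bool,
      if ExactRecovery U T ω z then (1 / 2 : ℝ) ^ Fintype.card T else 0 := by
  have hhalf : (0 : ℝ) < 1 / 2 := by norm_num
  choose y hy using fun t : Fin n => exists_mulVec_eq hhalf hM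
    (∑ k, (boolReal (ω k) * c * U k t) • rowOn U T k)
  have hyn : ∀ t, t ∉ T → y t ⬝ᵥ y t ≤ 4 * τ := by
    intro t ht
    have h1 := sq_mul_dotProduct_self_le hhalf.le hM (y t)
    rw [hy] at h1
    linarith [hv t ht]
  have hpt : ∀ z : T → Bool, (1 / 2 : ℝ) ^ Fintype.card T - ∑ t ∈ Tᶜ,
      (1 / 2 : ℝ) ^ Fintype.card T *
        (if 1 ≤ |∑ i, (if z i then 1 else -1) * y t i| then 1 else 0) ≤
      if ExactRecovery U T ω z then (1 / 2 : ℝ) ^ Fintype.card T else 0 := by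
    intro z
    have hnn : ∀ t ∈ Tᶜ, (0 : ℝ) ≤ (1 / 2 : ℝ) ^ Fintype.card T *
        (if 1 ≤ |∑ i, (if z i then 1 else -1) * y t i| then 1 else 0) :=
      fun t _ => by positivity
    split_ifs with hE
    · linarith [Finset.sum_nonneg hnn]
    · have : ∃ t, t ∉ T ∧ 1 ≤ |∑ i, (if z i then 1 else -1) * y t i| := by
        by_contra! hcon
        exact hE (exactRecovery_of_gram hhalf hM y (fun t _ => hy t) hcon)
      obtain ⟨t, ht, h1⟩ := this
      have := Finset.single_le_sum hnn (Finset.mem_compl.2 ht)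
      rw [if_pos h1, mul_one] at this
      linarith
  refine le_trans ?_ (Finset.sum_le_sum fun z _ => hpt z)
  rw [Finset.sum_sub_distrib, sum_half_pow, Finset.sum_comm]
  have : ∑ t ∈ Tᶜ, ∑ z : T → Bool, (1 / 2 : ℝ) ^ Fintype.card T *
        (if 1 ≤ |∑ i, (if z i then 1 else -1) * y t i| then 1 else 0) ≤
      ∑ t ∈ Tᶜ, 2 * exp (-(8 * τ)⁻¹) :=
    Finset.sum_le_sum fun t ht => tail_signs_le hτ (hyn t (Finset.mem_compl.1 ht))
  rw [Finset.sum_const, nsmul_eq_mul] at this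
  have hc : ((Tᶜ.card : ℕ) : ℝ) ≤ n := by
    exact_mod_cast (Finset.card_le_univ _).trans_eq (Fintype.card_fin n)
  have := mul_le_mul_of_nonneg_right hc (by positivity : 0 ≤ 2 * exp (-(8 * τ)⁻¹))
  linarith

theorem abs_le_coh {n : ℕ} (U : Matrix (Fin n) (Fin n) ℝ) (k j : Fin n) : |U k j| ≤ coh U :=
  (le_ciSup (f := fun j => |U k j|) (Set.finite_range _).bddAbove j).trans
    (le_ciSup (f := fun k => ⨆ j, |U k j|) (Set.finite_range _).bddAbove k)

theorem sq_le_coh_sq {n : ℕ} (U : Matrix (Fin n) (Fin n) ℝ) (k j : Fin n) :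
    U k j ^ 2 ≤ coh U ^ 2 :=
  sq_le_sq' (neg_le_of_abs_le (abs_le_coh U k j)) (le_of_abs_le (abs_le_coh U k j))

theorem sum_mul_col_eq {n : ℕ} {U : Matrix (Fin n) (Fin n) ℝ}
    (hU : Uᵀ * U = (n : ℝ) • (1 : Matrix (Fin n) (Fin n) ℝ)) (i j : Fin n) :
    ∑ k, U k i * U k j = if i = j then (n : ℝ) else 0 := by
  have := congrFun (congrFun hU i) j
  simpa [Matrix.mul_apply, Matrix.one_apply] using this

theorem rowOn_dotProduct_self_le {n : ℕ} (U : Matrix (Fin n) (Fin n) ℝ) (T : Finset (Fin n))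
    (k : Fin n) : rowOn U T k ⬝ᵥ rowOn U T k ≤ coh U ^ 2 * T.card := by
  calc rowOn U T k ⬝ᵥ rowOn U T k ≤ ∑ _i : T, coh U ^ 2 :=
        Finset.sum_le_sum fun i _ => by
          rw [rowOn_apply, ← sq]; exact sq_le_coh_sq U k i
    _ = _ := by simp [mul_comm]

theorem sum_vecMulVec_rowOn {n : ℕ} {U : Matrix (Fin n) (Fin n) ℝ}
    (hU : Uᵀ * U = (n : ℝ) • (1 : Matrix (Fin n) (Fin n) ℝ)) (T : Finset (Fin n)) :
    ∑ k, vecMulVec (rowOn U T k) (rowOn U T k) = (n : ℝ) • (1 : Matrix T T ℝ) := by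
  ext i j
  rw [Matrix.sum_apply]
  simp only [vecMulVec_apply, rowOn_apply, Matrix.smul_apply, Matrix.one_apply, smul_eq_mul,
    sum_mul_col_eq hU, mul_ite, mul_one, mul_zero, Subtype.ext_iff]

theorem sum_rowOn_dotProduct_sq {n : ℕ} {U : Matrix (Fin n) (Fin n) ℝ}
    (hU : Uᵀ * U = (n : ℝ) • (1 : Matrix (Fin n) (Fin n) ℝ)) (T : Finset (Fin n)) (x : T → ℝ) :
    ∑ k, (rowOn U T k ⬝ᵥ x) ^ 2 = n * (x ⬝ᵥ x) := by
  have h := congrArg (fun M => x ⬝ᵥ (M *ᵥ x)) (sum_vecMulVec_rowOn hU T)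
  simp only [Matrix.sum_mulVec, dotProduct_sum, smul_mulVec, one_mulVec, dotProduct_smul,
    smul_eq_mul, vecMulVec_mulVec, op_smul_eq_smul] at h
  rw [← h]
  exact Finset.sum_congr rfl fun k _ => by rw [dotProduct_comm x, sq]

theorem sum_smul_rowOn_eq_zero {n : ℕ} {U : Matrix (Fin n) (Fin n) ℝ}
    (hU : Uᵀ * U = (n : ℝ) • (1 : Matrix (Fin n) (Fin n) ℝ)) {T : Finset (Fin n)} {t : Fin n}
    (ht : t ∉ T) : ∑ k, U k t • rowOn U T k = 0 := by
  ext i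
  simp only [Finset.sum_apply, Pi.smul_apply, smul_eq_mul, rowOn_apply, sum_mul_col_eq hU]
  rw [if_neg]
  · rfl
  · rintro rfl; exact ht i.2

theorem prob_trace_pow_ge_le {n : ℕ} {ι : Type*} [Fintype ι] [DecidableEq ι]
    {p c r : ℝ} (h0 : 0 ≤ p) (h1 : p ≤ 1) (hc : 0 ≤ c) (hr0 : 0 ≤ r) (u : Fin n → ι → ℝ)
    (hr : ∀ k, c * (u k ⬝ᵥ u k) ≤ r)
    (hu : ∑ k, (p * c) • vecMulVec (u k) (u k) = 1) (N : ℕ) (hN : 2 * N * r ≤ 1 / 24) :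
    ∑ ω, bernoulliWeight p ω *
        (if (1 / 4) ^ N ≤ (centeredGram p c u ω ^ (2 * N)).trace then 1 else 0) ≤
      exp (-N) * Fintype.card ι := by
  have hE := expect_trace_pow_le h0 h1 hc hr0 u hr hu (by norm_num) N hN
  have hpt : ∀ ω, bernoulliWeight p ω *
        (if (1 / 4) ^ N ≤ (centeredGram p c u ω ^ (2 * N)).trace then 1 else 0) ≤
      4 ^ N * (bernoulliWeight p ω * (centeredGram p c u ω ^ (2 * N)).trace) := by
    intro ω
    rw [mul_left_comm]
    refine mul_le_mul_of_nonneg_left ?_ (bernoulliWeight_nonneg h0 h1 ω)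
    split_ifs with h
    · calc (1 : ℝ) = 4 ^ N * (1 / 4) ^ N := by rw [← mul_pow]; norm_num
        _ ≤ _ := mul_le_mul_of_nonneg_left h (by positivity)
    · exact mul_nonneg (by positivity)
        (trace_even_pow_nonneg (centeredGram_transpose p c u ω) (even_two_mul N))
  have hexp : (1 / 3 : ℝ) ^ N ≤ exp (-N) := by
    have e : exp (-(N : ℝ)) = exp (-1) ^ N := by rw [← Real.exp_nat_mul]; ring_nf
    rw [e]
    refine pow_le_pow_left₀ (by norm_num) ?_ N
    rw [Real.exp_neg, one_div]
    exact inv_anti₀ (Real.exp_pos 1) (Real.exp_one_lt_d9.le.trans (by norm_num))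
  calc _ ≤ 4 ^ N * ∑ ω, bernoulliWeight p ω * (centeredGram p c u ω ^ (2 * N)).trace := by
        rw [Finset.mul_sum]; exact Finset.sum_le_sum fun ω _ => hpt ω
    _ ≤ 4 ^ N * ((2 * (1 / 24)) ^ N * Fintype.card ι) :=
        mul_le_mul_of_nonneg_left hE (by positivity)
    _ = (1 / 3) ^ N * Fintype.card ι := by
        rw [← mul_assoc, ← mul_pow]; norm_num
    _ ≤ _ := mul_le_mul_of_nonneg_right hexp (by positivity)

theorem one_sub_le_sum_prob {n : ℕ} {U : Matrix (Fin n) (Fin n) ℝ} (hn : 0 < n)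
    (hU : Uᵀ * U = (n : ℝ) • (1 : Matrix (Fin n) (Fin n) ℝ)) {m : ℕ} (hm : 0 < m) (hmn : m ≤ n)
    (T : Finset (Fin n)) {L : ℝ} (hL : 2 / 3 ≤ L)
    (hmT : 2304 * coh U ^ 2 * T.card * L ≤ m) (hmL : 2304 * coh U ^ 2 * L ^ 2 ≤ m) :
    1 - 4 * n * exp (-(3 * L)) ≤ ∑ ω, bernoulliWeight ((m : ℝ) / n) ω * ∑ z : T → Bool,
      if ExactRecovery U T ω z then (1 / 2 : ℝ) ^ Fintype.card T else 0 := by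
  set p : ℝ := (m : ℝ) / n with hp
  set c : ℝ := (m : ℝ)⁻¹ with hc
  set D := coh U ^ 2 with hD
  have hD0 : 0 ≤ D := sq_nonneg _
  have hn' : (0 : ℝ) < n := by exact_mod_cast hn
  have hm' : (0 : ℝ) < m := by exact_mod_cast hm
  have hc0 : 0 < c := by positivity
  have hp0 : 0 ≤ p := by positivity
  have hp1 : p ≤ 1 := (div_le_one hn').2 (by exact_mod_cast hmn)
  have hL0 : 0 < L := by linarith
  have hcm : c * m = 1 := inv_mul_cancel₀ hm'.ne'
  have hpcn : p * c * n = 1 := by rw [hp, hc]; field_simp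
  set s : ℝ := (T.card : ℝ) with hs
  have hs0 : 0 ≤ s := by positivity
  -- the sampling rate bounds, normalised by `m`
  have hT1 : 2304 * (c * D * s) * L ≤ 1 := by
    have := mul_le_mul_of_nonneg_left hmT hc0.le
    rw [hcm] at this; linarith
  have hL1 : 2304 * (c * D) * L ^ 2 ≤ 1 := by
    have := mul_le_mul_of_nonneg_left hmL hc0.le
    rw [hcm] at this; linarith
  have hTL : 2304 ^ 2 * (c ^ 2 * D ^ 2 * s) * L ^ 3 ≤ 1 := by
    have := mul_le_mul hT1 hL1 (by positivity) zero_le_one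
    linarith
  set τ : ℝ := (24 * L)⁻¹ with hτ
  have hτ0 : 0 < τ := by positivity
  have hτL : τ * (24 * L) = 1 := inv_mul_cancel₀ (by positivity)
  set t : ℝ := 144 * L ^ 2 with ht
  have ht0 : 0 < t := by positivity
  have htτ : t * τ = 6 * L := by
    rw [ht]; linear_combination (6 * L) * hτL
  have hrow := rowOn_dotProduct_self_le U T
  have hu : ∑ k, (p * c) • vecMulVec (rowOn U T k) (rowOn U T k) = 1 := by
    rw [← Finset.smul_sum, sum_vecMulVec_rowOn hU, smul_smul, hpcn, one_smul]
  set N := ⌈3 * L⌉₊ with hN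
  have hN1 : 3 * L ≤ N := Nat.le_ceil _
  have hN2 : (N : ℝ) < 3 * L + 1 := Nat.ceil_lt_add_one (by positivity)
  have hr0 : 0 ≤ c * D * s := by positivity
  have hgram := prob_trace_pow_ge_le hp0 hp1 hc0.le hr0 (rowOn U T)
    (fun k => by
      rw [mul_assoc]; exact mul_le_mul_of_nonneg_left (hrow k) hc0.le) hu N (by
      have : 2 * (N : ℝ) * (c * D * s) ≤ 2 * (9 / 2 * L) * (c * D * s) :=
        mul_le_mul_of_nonneg_right (by linarith) hr0
      linarith)
  have hgram' : ∑ ω, bernoulliWeight p ω * (if (1 / 4) ^ N ≤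
      (centeredGram p c (rowOn U T) ω ^ (2 * N)).trace then 1 else 0) ≤ n * exp (-(3 * L)) := by
    refine hgram.trans ?_
    rw [mul_comm]
    refine mul_le_mul ?_ (Real.exp_le_exp.2 (by linarith)) (Real.exp_nonneg _) hn'.le
    rw [Fintype.card_coe]
    exact_mod_cast (Finset.card_le_univ T).trans_eq (Fintype.card_fin n)
  set b : Fin n → Fin n → T → ℝ := fun j k => (c * U k j) • rowOn U T k with hb
  have hbx : ∀ j k x, (b j k ⬝ᵥ x) = c * U k j * (rowOn U T k ⬝ᵥ x) := by
    intro j k x; rw [hb]; simp only [smul_dotProduct, smul_eq_mul]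
  have hbb : ∀ j k, b j k ⬝ᵥ b j k ≤ c ^ 2 * U k j ^ 2 * (D * s) := by
    intro j k
    rw [hbx, hb]
    simp only [dotProduct_smul, smul_eq_mul]
    calc _ = c ^ 2 * U k j ^ 2 * (rowOn U T k ⬝ᵥ rowOn U T k) := by ring
      _ ≤ _ := mul_le_mul_of_nonneg_left (hrow k) (by positivity)
  have hbb' : ∀ j k, b j k ⬝ᵥ b j k ≤ c ^ 2 * D ^ 2 * s := by
    intro j k
    refine (hbb j k).trans ?_
    have := mul_le_mul_of_nonneg_left (sq_le_coh_sq U k j)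
      (by positivity : 0 ≤ c ^ 2 * (D * s))
    rw [← hD] at this
    linarith
  have hvec : ∀ j, ∑ ω, bernoulliWeight p ω *
      (if τ < (∑ k, (boolReal (ω k) - p) • b j k) ⬝ᵥ (∑ k, (boolReal (ω k) - p) • b j k)
        then 1 else 0) ≤ exp (-(3 * L)) := by
    intro j
    have hQ0 : 0 ≤ c ^ 2 * D ^ 2 * s := by positivity
    have key := tail_sum_centered_le (τ := τ) hp0 hp1 ht0 n (b j)
      (fun k => by
        have h1 := mul_le_mul_of_nonneg_left (hbb' j k) ht0.le
        have h2 : 2304 * (t * (c ^ 2 * D ^ 2 * s)) * (16 * L) ≤ 1 := by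
          rw [ht]; linarith
        have h3 : 0 ≤ t * (c ^ 2 * D ^ 2 * s) := by positivity
        nlinarith)
      (fun k => by
        have h1 := mul_le_mul_of_nonneg_left (hbb' j k)
          (by positivity : 0 ≤ 64 * t ^ 2 * τ)
        have h2 : 64 * t ^ 2 * τ = 55296 * L ^ 3 := by
          rw [sq, ← mul_assoc, mul_assoc (64 * t), htτ, ht]; ring
        rw [h2] at h1 ⊢
        have h3 : 0 ≤ (c ^ 2 * D ^ 2 * s) * L ^ 3 := by positivity
        linarith)
      (fun x => by
        have h1 : ∑ k, (b j k ⬝ᵥ x) ^ 2 ≤ c ^ 2 * D * (n * (x ⬝ᵥ x)) := by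
          rw [← sum_rowOn_dotProduct_sq hU T x, Finset.mul_sum]
          refine Finset.sum_le_sum fun k _ => ?_
          rw [hbx, mul_pow, mul_pow]
          exact mul_le_mul_of_nonneg_right
            (mul_le_mul_of_nonneg_left (sq_le_coh_sq U k j) (sq_nonneg c)) (sq_nonneg _)
        have h2 : 8 * p * (c ^ 2 * D * (n * (x ⬝ᵥ x))) = 8 * (c * D) * (x ⬝ᵥ x) := by
          linear_combination (8 * c * D * (x ⬝ᵥ x)) * hpcn
        refine (mul_le_mul_of_nonneg_left h1 (by positivity)).trans (h2.trans_le ?_)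
        refine mul_le_mul_of_nonneg_right ?_ (dotProduct_self_nonneg' x)
        rw [← one_div, le_div_iff₀ (by positivity), ht]
        linarith)
      0 0 (mulVec_zero _)
    simp only [zero_add, dotProduct_zero] at key
    refine key.trans (Real.exp_le_exp.2 ?_)
    have h1 : ∑ k, b j k ⬝ᵥ b j k ≤ c ^ 2 * (D * s) * n := by
      refine (Finset.sum_le_sum fun k _ => hbb j k).trans_eq ?_
      have := sum_mul_col_eq hU j j
      rw [if_pos rfl] at this
      rw [← this, Finset.mul_sum]
      exact Finset.sum_congr rfl fun k _ => by ring
    have h2 := mul_le_mul_of_nonneg_left h1 (by positivity : 0 ≤ 4 * t * p)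
    have h3 : 4 * t * p * (c ^ 2 * (D * s) * n) = 4 * t * (c * D * s) := by
      linear_combination (4 * t * c * D * s) * hpcn
    have h4 : 4 * t * (c * D * s) ≤ 3 * L := by
      rw [ht]; nlinarith
    rw [htτ]
    linarith
  set ind : (Fin n → Bool) → ℝ := fun ω => if (1 / 4) ^ N ≤
      (centeredGram p c (rowOn U T) ω ^ (2 * N)).trace then 1 else 0 with hind
  set jnd : Fin n → (Fin n → Bool) → ℝ := fun j ω =>
    if τ < (∑ k, (boolReal (ω k) - p) • b j k) ⬝ᵥ (∑ k, (boolReal (ω k) - p) • b j k)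
        then 1 else 0 with hjnd
  have hind0 : ∀ ω, 0 ≤ ind ω := fun ω => by rw [hind]; positivity
  have hjnd0 : ∀ j ω, 0 ≤ jnd j ω := fun j ω => by rw [hjnd]; positivity
  have h8τ : (8 * τ)⁻¹ = 3 * L := by
    rw [hτ]; field_simp; norm_num
  have hpt : ∀ ω, 1 - n * (2 * exp (-(3 * L))) - ind ω - ∑ j, jnd j ω ≤
      ∑ z : T → Bool, if ExactRecovery U T ω z then (1 / 2 : ℝ) ^ Fintype.card T else 0 := by
    intro ω
    have hnn : (0 : ℝ) ≤ ∑ z : T → Bool,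
        if ExactRecovery U T ω z then (1 / 2 : ℝ) ^ Fintype.card T else 0 :=
      Finset.sum_nonneg fun z _ => by positivity
    have hE0 : 0 ≤ n * (2 * exp (-(3 * L))) := by positivity
    have hsum0 : 0 ≤ ∑ j, jnd j ω := Finset.sum_nonneg fun j _ => hjnd0 j ω
    by_cases hA : (1 / 4) ^ N ≤ (centeredGram p c (rowOn U T) ω ^ (2 * N)).trace
    · have : ind ω = 1 := if_pos hA
      linarith
    by_cases hB : ∃ j, τ < (∑ k, (boolReal (ω k) - p) • b j k) ⬝ᵥ
        (∑ k, (boolReal (ω k) - p) • b j k)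
    · obtain ⟨j, hj⟩ := hB
      have h1 : jnd j ω = 1 := if_pos hj
      have h2 := Finset.single_le_sum (f := fun j => jnd j ω) (fun j _ => hjnd0 j ω)
        (Finset.mem_univ j)
      simp only [h1] at h2
      linarith [hind0 ω]
    push Not at hA hB
    have hM : ∑ k, (boolReal (ω k) * c) • vecMulVec (rowOn U T k) (rowOn U T k) =
        1 + centeredGram p c (rowOn U T) ω := by
      rw [← hu, centeredGram, ← Finset.sum_add_distrib]
      refine Finset.sum_congr rfl fun k _ => ?_
      rw [← add_smul]; congr 1; ring
    have hgood := one_sub_le_prob_signs_exactRecovery (U := U) (T := T) (ω := ω) (c := c) hτ0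
      (fun x => by
        rw [hM, add_mulVec, one_mulVec, dotProduct_add]
        have := (abs_le.1 (dotProduct_mulVec_le_of_trace_pow
          (centeredGram_transpose p c (rowOn U T) ω) hA x)).1
        linarith)
      (fun j hj => by
        have e : ∑ k, (boolReal (ω k) * c * U k j) • rowOn U T k =
            ∑ k, (boolReal (ω k) - p) • b j k := by
          have h0 : ∑ k, (p * c) • (U k j • rowOn U T k) = 0 := by
            rw [← Finset.smul_sum, sum_smul_rowOn_eq_zero hU hj, smul_zero]
          rw [← sub_zero (∑ k, (boolReal (ω k) * c * U k j) • rowOn U T k), ← h0,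
            ← Finset.sum_sub_distrib]
          refine Finset.sum_congr rfl fun k _ => ?_
          rw [hb]
          simp only [smul_smul]
          rw [← sub_smul]; congr 1; ring
        rw [e]
        exact hB j)
    rw [h8τ] at hgood
    linarith [hind0 ω]
  have hfin := Finset.sum_le_sum fun ω (_ : ω ∈ (Finset.univ : Finset (Fin n → Bool))) =>
    mul_le_mul_of_nonneg_left (hpt ω) (bernoulliWeight_nonneg hp0 hp1 ω)
  refine le_trans ?_ hfin
  simp only [mul_sub, mul_one, Finset.sum_sub_distrib, ← Finset.sum_mul, sum_bernoulliWeight,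
    one_mul]
  have hswap : ∑ ω, bernoulliWeight p ω * ∑ j, jnd j ω ≤ n * exp (-(3 * L)) := by
    simp only [Finset.mul_sum]
    rw [Finset.sum_comm]
    refine (Finset.sum_le_sum fun j _ => hvec j).trans_eq ?_
    simp
  linarith

theorem coh_pos {n : ℕ} {U : Matrix (Fin n) (Fin n) ℝ} (hn : 0 < n)
    (hU : Uᵀ * U = (n : ℝ) • (1 : Matrix (Fin n) (Fin n) ℝ)) : 0 < coh U := by
  have h1 := sum_mul_col_eq hU ⟨0, hn⟩ ⟨0, hn⟩
  rw [if_pos rfl] at h1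
  have h2 : (0 : ℝ) < n := by exact_mod_cast hn
  by_contra! h
  have h3 : ∀ k j, U k j = 0 := fun k j =>
    abs_eq_zero.1 (le_antisymm ((abs_le_coh U k j).trans h) (abs_nonneg _))
  simp only [h3, mul_zero, Finset.sum_const_zero] at h1
  linarith

theorem jprob_exactRecovery_eq {n : ℕ} (m : ℕ) (U : Matrix (Fin n) (Fin n) ℝ)
    (T : Finset (Fin n)) :
    jprob n m (T := T) (fun p => ExactRecovery U T p.1 p.2) =
      ∑ ω, bernoulliWeight ((m : ℝ) / n) ω * ∑ z : T → Bool,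
        if ExactRecovery U T ω z then (1 / 2 : ℝ) ^ Fintype.card T else 0 := by
  rw [jprob, Fintype.sum_prod_type]
  refine Finset.sum_congr rfl fun ω _ => ?_
  rw [Finset.mul_sum]
  refine Finset.sum_congr rfl fun z _ => ?_
  rw [mul_ite, mul_zero, Fintype.card_coe]
  rfl

theorem jprob_exactRecovery_full {n : ℕ} {U : Matrix (Fin n) (Fin n) ℝ}
    (hU : Uᵀ * U = (n : ℝ) • (1 : Matrix (Fin n) (Fin n) ℝ)) (T : Finset (Fin n)) :
    jprob n n (T := T) (fun p => ExactRecovery U T p.1 p.2) = 1 := by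
  rw [jprob_exactRecovery_eq]
  refine (Finset.sum_congr rfl fun ω _ => ?_).trans
    (sum_bernoulliWeight ((n : ℝ) / n) (ι := Fin n))
  by_cases hω : ∀ k, ω k = true
  · have hE : ∀ z, ExactRecovery U T ω z := by
      intro z x0 _ _ x hx hne
      refine absurd ?_ hne
      have h1 : U *ᵥ x = U *ᵥ x0 := funext fun k => hx k (hω k)
      have h2 := congrArg (Uᵀ *ᵥ ·) h1
      simp only [mulVec_mulVec, hU, smul_mulVec, one_mulVec] at h2
      funext k
      have hn : (n : ℝ) ≠ 0 := by exact_mod_cast (Fin.pos k).ne'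
      exact mul_left_cancel₀ hn (congrFun h2 k)
    simp only [hE, if_true, sum_half_pow, mul_one]
  · push Not at hω
    obtain ⟨k, hk⟩ := hω
    have hn : (n : ℝ) ≠ 0 := by exact_mod_cast (Fin.pos k).ne'
    have : bernoulliWeight ((n : ℝ) / n) ω = 0 :=
      Finset.prod_eq_zero (Finset.mem_univ k) (by simp [hk, div_self hn])
    rw [this, zero_mul]

/-- There is an absolute constant `K₃ > 0` such that: for `U`
with `UᵀU = n•I`, coherence `μ`, fixed `T`, `δ ∈ (0,1)`, Bernoulli-sampled
`Ω = {k : δ_k = 1}` with `P(δ_k = 1) = m/n`, and an independent uniformly random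
sign sequence `z` on `T`, if `m ≥ K₃·μ²·max(|T|, log(n/δ))·log(n/δ)` then with
probability at least `1-δ` every `x⁰` supported on `T` with signs `z` is the
unique minimizer of `‖x‖₁` subject to `U_Ω x = U_Ω x⁰`. -/
theorem statement1 :
    ∃ K₃ : ℝ, 0 < K₃ ∧
      ∀ (n m : ℕ) (U : Matrix (Fin n) (Fin n) ℝ),
        Uᵀ * U = (n : ℝ) • (1 : Matrix (Fin n) (Fin n) ℝ) →
        ∀ (T : Finset (Fin n)) (δ : ℝ),
          0 < δ → δ < 1 → m ≤ n →
          K₃ * coh U ^ 2 * max (T.card : ℝ) (Real.log (n / δ)) * Real.log (n / δ) ≤ m →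
          1 - δ ≤
            jprob n m (T := T)
              (fun p =>
                ∀ x0 : Fin n → ℝ,
                  (∀ t, t ∉ T → x0 t = 0) →
                  (∀ t (ht : t ∈ T),
                    Real.sign (x0 t) = (if p.2 ⟨t, ht⟩ then 1 else -1)) →
                  ∀ x : Fin n → ℝ,
                    (∀ k : Fin n, p.1 k = true → U.mulVec x k = U.mulVec x0 k) →
                    x ≠ x0 →
                    ∑ i, |x0 i| < ∑ i, |x i|) := by
  refine ⟨2304, by norm_num, fun n m U hU T δ hδ0 hδ1 hmn hm => ?_⟩
  change 1 - δ ≤ jprob n m (T := T) (fun p => ExactRecovery U T p.1 p.2)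
  rcases Nat.eq_zero_or_pos n with rfl | hn
  · obtain rfl : m = 0 := by omega
    rw [jprob_exactRecovery_full hU]
    linarith
  have hn' : (1 : ℝ) ≤ n := by exact_mod_cast hn
  set L := Real.log (n / δ) with hL
  have hLpos : 0 < L := Real.log_pos ((one_lt_div hδ0).2 (by linarith))
  have hcoh := coh_pos hn hU
  have hmax : L ≤ max (T.card : ℝ) L := le_max_right _ _
  have hm0 : 0 < m := by
    have : 0 < 2304 * coh U ^ 2 * max (T.card : ℝ) L * L := by
      have : 0 < max (T.card : ℝ) L := hLpos.trans_le hmax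
      positivity
    exact_mod_cast this.trans_le hm
  rcases Nat.lt_or_ge n 2 with h2 | h2
  · obtain rfl : m = n := by omega
    rw [jprob_exactRecovery_full hU]
    linarith
  have hn2 : (2 : ℝ) ≤ n := by exact_mod_cast h2
  have hL2 : 2 / 3 ≤ L := by
    have h1 : Real.log 2 ≤ L := Real.log_le_log (by norm_num)
      ((le_div_iff₀ hδ0).2 (by nlinarith))
    linarith [Real.log_two_gt_d9]
  have key := one_sub_le_sum_prob hn hU hm0 hmn T hL2
    (le_trans (by gcongr; exact le_max_left _ _) hm)
    (le_trans (by rw [sq L, ← mul_assoc]; gcongr) hm)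
  rw [jprob_exactRecovery_eq]
  refine le_trans ?_ key
  have hexp : exp (-(3 * L)) = (δ / n) ^ 3 := by
    have e : -(3 * L) = (3 : ℕ) * -L := by push_cast; ring
    rw [e, Real.exp_nat_mul, Real.exp_neg, hL, Real.exp_log (by positivity), inv_div]
  rw [hexp]
  have h3 : 4 * n * (δ / n) ^ 3 = δ * (δ ^ 2 * (4 / (n : ℝ) ^ 2)) := by
    field_simp
  have h4 : 4 / (n : ℝ) ^ 2 ≤ 1 := (div_le_one (by positivity)).2 (by nlinarith)
  have h5 : δ ^ 2 * (4 / (n : ℝ) ^ 2) ≤ 1 :=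
    mul_le_one₀ (pow_le_one₀ hδ0.le hδ1.le) (by positivity) h4
  rw [h3]
  nlinarith
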